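/- Under FP with inertia and fading memory in a common-payoff game with pairwise-distinct terminal payoffs, suppose that for some t_0 ∈ ℕ and n ∈ ℕ_0 the event Ê_{t_0} ∩ Ê_{t_1} ∩ … ∩ Ê_{t_n} occurs, where t_{ℓ+1} := t_ℓ + K_{t_ℓ} + m_{t_ℓ} + 1 for all ℓ ∈ {0,…,n} and m_{t_0},…,m_{t_n} < ∞. Then for each ℓ ∈ {0,…,n}: if z_{t_{ℓ+1}} ∈ {z_{t_0},…,z_{t_ℓ}}, then u(z_{t_{ℓ+1}}) > u(z_{t_ℓ}). -/

import Mathlib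

open Classical Filter MeasureTheory
open scoped BigOperators

noncomputable section

/-- A finite extensive-form game (no chance moves): a finite rooted tree with
decision and terminal nodes, moves, information sets and players. -/
structure ExtGame where
  Node : Type
  Move : Type
  Info : Type
  Player : Type
  nodeFintype : Fintype Node
  nodeDecEq : DecidableEq Node
  moveFintype : Fintype Move
  moveDecEq : DecidableEq Move
  infoFintype : Fintype Info
  infoDecEq : DecidableEq Info
  playerFintype : Fintype Player
  playerDecEq : DecidableEq Player
  root : Node
  /-- the immediate predecessor of a node together with the move leading from it;
  `none` exactly at the root -/
  parentMove : Node → Option (Node × Move)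
  /-- depth of a node in the tree (ensures acyclicity) -/
  rank : Node → ℕ
  parentMove_root : parentMove root = none
  eq_root_of_parentMove_eq_none : ∀ n, parentMove n = none → n = root
  rank_succ : ∀ n m a, parentMove n = some (m, a) → rank n = rank m + 1
  /-- decision nodes; the remaining nodes are terminal -/
  decision : Node → Prop
  /-- the information set containing a (decision) node -/
  info : Node → Info
  /-- the player moving at an information set -/
  player : Info → Player
  /-- the set of moves available at an information set -/
  avail : Info → Finset Move
  avail_nonempty : ∀ h, (avail h).Nonempty
  /-- moves are in bijection with immediate successors -/
  child_exists : ∀ n, decision n → ∀ a ∈ avail (info n), ∃! n', parentMove n' = some (n, a)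
  parent_decision : ∀ n' n a, parentMove n' = some (n, a) → decision n ∧ a ∈ avail (info n)
  /-- information sets partition the set of decision nodes -/
  info_surjOn_decision : ∀ h, ∃ n, decision n ∧ info n = h
  root_decision : decision root
  /-- the information set of the root is the singleton {root} -/
  root_info_singleton : ∀ n, decision n → info n = info root → n = root
  exists_terminal : ∃ n, ¬ decision n

namespace ExtGame

variable (G : ExtGame)

instance : Fintype G.Node := G.nodeFintype
instance : DecidableEq G.Node := G.nodeDecEq
instance : Fintype G.Move := G.moveFintype
instance : DecidableEq G.Move := G.moveDecEq
instance : Fintype G.Info := G.infoFintype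
instance : DecidableEq G.Info := G.infoDecEq
instance : Fintype G.Player := G.playerFintype
instance : DecidableEq G.Player := G.playerDecEq

/-- auxiliary, fuel-based computation of the list of (information set, move) pairs
crossed on the unique path from the root to a node -/
def pathAux : ℕ → G.Node → List (G.Info × G.Move)
  | 0, _ => []
  | fuel + 1, n =>
    match G.parentMove n with
    | none => []
    | some (m, a) => pathAux fuel m ++ [(G.info m, a)]

/-- the list of (information set, move) pairs crossed on the unique path from the
root to a node; since `rank` increases by exactly one along each edge, the fuel
`G.rank n` is always sufficient -/
def pathPairs (n : G.Node) : List (G.Info × G.Move) := G.pathAux (G.rank n) n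

/-- `(h, a) ⊑ n` : the path from the root to `n` goes through `h`, taking move `a` -/
def chooses (h : G.Info) (a : G.Move) (n : G.Node) : Prop := (h, a) ∈ G.pathPairs n

/-- `h ⊑ n` : the path from the root to `n` goes through the information set `h` -/
def visits (h : G.Info) (n : G.Node) : Prop := ∃ a, G.chooses h a n

/-- terminal nodes -/
def terminalSet : Finset G.Node := Finset.univ.filter fun n => ¬ G.decision n

/-- a behavioral strategy profile: a probability distribution on `avail h` for each
information set `h` -/
def IsProfile (g : G.Info → G.Move → ℝ) : Prop :=
  (∀ h a, 0 ≤ g h a) ∧ (∀ h, ∑ a ∈ G.avail h, g h a = 1) ∧ ∀ h a, a ∉ G.avail h → g h a = 0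

/-- probability of reaching node `n` under profile `g` -/
def reachProb (g : G.Info → G.Move → ℝ) (n : G.Node) : ℝ :=
  ((G.pathPairs n).map fun p => g p.1 p.2).prod

/-- expected payoff (for payoff function `u` on terminal nodes) under profile `g` -/
def eu (u : G.Node → ℝ) (g : G.Info → G.Move → ℝ) : ℝ :=
  ∑ z ∈ G.terminalSet, u z * G.reachProb g z

/-- `(a, g^{-h})` : the profile `g` with `g (·|h)` replaced by the point mass at `a` -/
def replace (g : G.Info → G.Move → ℝ) (h : G.Info) (a : G.Move) : G.Info → G.Move → ℝ :=
  fun h' b => if h' = h then (if b = a then 1 else 0) else g h' b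

/-- `max_{a ∈ A^h} u(a, g^{-h})` -/
def brMax (u : G.Node → ℝ) (g : G.Info → G.Move → ℝ) (h : G.Info) : ℝ :=
  ((G.avail h).image fun a => G.eu u (G.replace g h a)).max' ((G.avail_nonempty h).image _)

/-- the move `a` is a (local) best reply at `h` against `g` -/
def IsBR (u : G.Node → ℝ) (g : G.Info → G.Move → ℝ) (h : G.Info) (a : G.Move) : Prop :=
  a ∈ G.avail h ∧ G.eu u (G.replace g h a) = G.brMax u g h

/-- the optimality gap `V_g(h)` of the profile `g` at the information set `h`,
for the payoff function `u` of the player moving at `h` -/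
def gap (u : G.Node → ℝ) (g : G.Info → G.Move → ℝ) (h : G.Info) : ℝ :=
  G.brMax u g h - G.eu u g

/-- the experience of player `i` on the path to a node: the information sets of `i`
crossed and the moves taken there -/
def experience (i : G.Player) (n : G.Node) : List (G.Info × G.Move) :=
  (G.pathPairs n).filter fun p => G.player p.1 = i

/-- perfect recall: two nodes in the same information set give its player identical
experiences -/
def PerfectRecall : Prop :=
  ∀ n m : G.Node, G.decision n → G.decision m → G.info n = G.info m →
    G.experience (G.player (G.info n)) n = G.experience (G.player (G.info n)) m

/-- indicator `I_t(h)` that the information set `h` is visited on the path to `n` -/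
def visitInd (h : G.Info) (n : G.Node) : ℝ := if G.visits h n then 1 else 0

/-- indicator `I_t(a)` that the move `a` is chosen at `h` on the path to `n` -/
def chooseInd (h : G.Info) (a : G.Move) (n : G.Node) : ℝ := if G.chooses h a n then 1 else 0

/-- `#_t(h)` : the number of rounds `1,…,t` in which `h` is visited -/
def visitCount (z : ℕ → G.Node) (t : ℕ) (h : G.Info) : ℝ :=
  ∑ k ∈ Finset.Icc 1 t, G.visitInd h (z k)

/-- The fictitious play process: in round `t = 1,2,…` the play path reaches the
terminal node `z t`; `f t` are the empirical frequencies entering round `t`;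
every move made on the realized path is a local best reply against `f t`. -/
structure IsFP (payoff : G.Player → G.Node → ℝ) (f : ℕ → G.Info → G.Move → ℝ)
    (z : ℕ → G.Node) : Prop where
  profile : ∀ t, 1 ≤ t → G.IsProfile (f t)
  terminal : ∀ t, 1 ≤ t → ¬ G.decision (z t)
  update : ∀ t, 1 ≤ t → ∀ h a,
    f (t + 1) h a = f t h a +
      G.visitInd h (z t) / G.visitCount z t h * (G.chooseInd h a (z t) - f t h a)
  bestReply : ∀ t, 1 ≤ t → ∀ h a, G.chooses h a (z t) →
    G.eu (payoff (G.player h)) (G.replace (f t) h a) = G.brMax (payoff (G.player h)) (f t) h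

end ExtGame

namespace ExtGame

/-- the deterministic fading-memory update map `𝔉₁(·, z)`:
`g(a|h) ↦ g(a|h) + ρ I(h)(I(a) − g(a|h))` for the play path reaching `zz` -/
def fadeStep (G : ExtGame) (ρ : ℝ) (zz : G.Node) (g : G.Info → G.Move → ℝ) :
    G.Info → G.Move → ℝ :=
  fun h a => g h a + ρ * G.visitInd h zz * (G.chooseInd h a zz - g h a)

/-- `(g, zz)` is an `ℓ`-step locked state: every move on the path to `zz` stays a
best reply for `ℓ` further fading-memory updates -/
def LockedUpTo (G : ExtGame) (u : G.Node → ℝ) (ρ : ℝ) (ℓ : ℕ)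
    (g : G.Info → G.Move → ℝ) (zz : G.Node) : Prop :=
  ∀ p ∈ G.pathPairs zz, ∀ m : ℕ, 1 ≤ m → m ≤ ℓ →
    G.IsBR u ((G.fadeStep ρ zz)^[m] g) p.1 p.2

/-- `(g, zz)` is a locked state -/
def Locked (G : ExtGame) (u : G.Node → ℝ) (ρ : ℝ)
    (g : G.Info → G.Move → ℝ) (zz : G.Node) : Prop :=
  ∀ p ∈ G.pathPairs zz, ∀ m : ℕ, 1 ≤ m →
    G.IsBR u ((G.fadeStep ρ zz)^[m] g) p.1 p.2

/-- `u_max := max_{z ∈ Z} |u(z)|` -/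
def umax (G : ExtGame) (u : G.Node → ℝ) : ℝ :=
  sSup {x : ℝ | ∃ zz ∈ G.terminalSet, x = |u zz|}

/-- `Δ_min := min_{z ≠ z̄} |u(z) − u(z̄)|` -/
def dmin (G : ExtGame) (u : G.Node → ℝ) : ℝ :=
  sInf {x : ℝ | ∃ zz ∈ G.terminalSet, ∃ zz' ∈ G.terminalSet, zz ≠ zz' ∧ x = |u zz - u zz'|}

/-- `L_max`: the maximum number of moves on any root-to-terminal path -/
def lmax (G : ExtGame) : ℕ := G.terminalSet.sup fun zz => (G.pathPairs zz).length

/-- the threshold `(1 − Δ_min/(8 u_max))^{1/L_max}` -/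
def thr (G : ExtGame) (u : G.Node → ℝ) : ℝ :=
  (1 - G.dmin u / (8 * G.umax u)) ^ ((G.lmax : ℝ)⁻¹)

/-- `K_max`: the smallest integer with `1 − (1−ρ)^{K+1} ≥ (1 − Δ_min/(8u_max))^{1/L_max}` -/
def Kmax (G : ExtGame) (u : G.Node → ℝ) (ρ : ℝ) : ℕ :=
  sInf {K : ℕ | G.thr u ≤ 1 - (1 - ρ) ^ (K + 1)}

/-- `K_t`: the smallest integer such that `K_t + 1` repetitions of `z_t` push all
empirical frequencies on its path above the threshold -/
def Kt (G : ExtGame) (u : G.Node → ℝ) (ρ : ℝ) (f : ℕ → G.Info → G.Move → ℝ)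
    (z : ℕ → G.Node) (t : ℕ) : ℕ :=
  sInf {K : ℕ | ∀ p ∈ G.pathPairs (z t),
    G.thr u ≤ (1 - ρ) ^ (K + 1) * f t p.1 p.2 + 1 - (1 - ρ) ^ (K + 1)}

/-- `m_t ∈ ℕ∞`: the smallest `m` with `(𝔉_{K_t}(f_t,z_t), z_t) ∉ Λ_{m+1}`
(`⊤` if `(𝔉_{K_t}(f_t,z_t), z_t)` is a locked state) -/
def mt (G : ExtGame) (u : G.Node → ℝ) (ρ : ℝ) (f : ℕ → G.Info → G.Move → ℝ)
    (z : ℕ → G.Node) (t : ℕ) : ℕ∞ :=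
  ⨅ (m : ℕ) (_ : ¬ G.LockedUpTo u ρ (m + 1)
      ((G.fadeStep ρ (z t))^[G.Kt u ρ f z t] (f t)) (z t)), (m : ℕ∞)

/-- the repeat event `E_t = {z_t = z_{t+1} = … = z_{t+K_t}}` -/
def repeatEvent (G : ExtGame) (u : G.Node → ℝ) (ρ : ℝ) (f : ℕ → G.Info → G.Move → ℝ)
    (z : ℕ → G.Node) (t : ℕ) : Prop :=
  ∀ k ≤ G.Kt u ρ f z t, z (t + k) = z t

/-- `s_t := t + K_t + m_t`, the last round of the forced repetitions -/
def st (G : ExtGame) (u : G.Node → ℝ) (ρ : ℝ) (f : ℕ → G.Info → G.Move → ℝ)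
    (z : ℕ → G.Node) (t : ℕ) : ℕ :=
  t + G.Kt u ρ f z t + (G.mt u ρ f z t).toNat

/-- the repeat-lock event `Ē_t` -/
def repeatLockEvent (G : ExtGame) (u : G.Node → ℝ) (ρ : ℝ)
    (f : ℕ → G.Info → G.Move → ℝ) (z : ℕ → G.Node) (t : ℕ) : Prop :=
  if G.mt u ρ f z t = ⊤ then ∀ τ, t ≤ τ → z τ = z t
  else ∀ k ≤ G.Kt u ρ f z t + (G.mt u ρ f z t).toNat, z (t + k) = z t

/-- `Ẑ_{s_t+1}`: the terminal nodes reachable from `z_{s_t}` by deviating at a single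
information set on its path to a strictly improving move while repeating all other
previous moves -/
def devSet (G : ExtGame) (u : G.Node → ℝ) (ρ : ℝ) (f : ℕ → G.Info → G.Move → ℝ)
    (z : ℕ → G.Node) (A : ℕ → G.Info → G.Move) (t : ℕ) : Set G.Node :=
  {z' | ¬ G.decision z' ∧ ∃ hbar abar ahat, (hbar, abar) ∈ G.pathPairs (z (G.st u ρ f z t)) ∧
    ahat ∈ G.avail hbar ∧
    G.eu u (G.replace (f (G.st u ρ f z t + 1)) hbar abar) <
      G.eu u (G.replace (f (G.st u ρ f z t + 1)) hbar ahat) ∧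
    ∀ p ∈ G.pathPairs z', p.2 = if p.1 = hbar then ahat else A (G.st u ρ f z t) p.1}

/-- the repeat-lock-deviate event `Ê_t` -/
def deviateEvent (G : ExtGame) (u : G.Node → ℝ) (ρ : ℝ) (f : ℕ → G.Info → G.Move → ℝ)
    (z : ℕ → G.Node) (A : ℕ → G.Info → G.Move) (t : ℕ) : Prop :=
  G.repeatLockEvent u ρ f z t ∧ z (G.st u ρ f z t + 1) ∈ G.devSet u ρ f z A t

/-- the sequence of rounds `t_0, t_1, …` with `t_{ℓ+1} = t_ℓ + K_{t_ℓ} + m_{t_ℓ} + 1` -/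
def tseq (G : ExtGame) (u : G.Node → ℝ) (ρ : ℝ) (f : ℕ → G.Info → G.Move → ℝ)
    (z : ℕ → G.Node) (t0 : ℕ) : ℕ → ℕ
  | 0 => t0
  | ℓ + 1 => G.st u ρ f z (tseq G u ρ f z t0 ℓ) + 1

/-- A possible trajectory of fictitious play with inertia (parameters `α h ∈ (0,1)`)
and fading memory (parameter `ρ ∈ (0,1)`) in the game `G` with common payoff `u`:
`f t` are the (fading-memory) empirical frequencies, `A t` is the pure profile of
round `t` (the most recent move at every information set), and `z t` is the terminal
node reached in round `t`. -/
structure IsFPInertiaPath (G : ExtGame) (u : G.Node → ℝ) (ρ : ℝ) (α : G.Info → ℝ)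
    (f : ℕ → G.Info → G.Move → ℝ) (A : ℕ → G.Info → G.Move) (z : ℕ → G.Node) :
    Prop where
  rho_mem : ρ ∈ Set.Ioo (0 : ℝ) 1
  alpha_mem : ∀ h, α h ∈ Set.Ioo (0 : ℝ) 1
  profile : ∀ t, 1 ≤ t → G.IsProfile (f t)
  pure_valid : ∀ t, 1 ≤ t → ∀ h, A t h ∈ G.avail h
  terminal : ∀ t, 1 ≤ t → ¬ G.decision (z t)
  outcome : ∀ t, 1 ≤ t → ∀ p ∈ G.pathPairs (z t), A t p.1 = p.2
  update : ∀ t, 1 ≤ t → f (t + 1) = G.fadeStep ρ (z t) (f t)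
  inertia_unreached : ∀ t, 2 ≤ t → ∀ h, ¬ G.visits h (z t) → A t h = A (t - 1) h
  inertia_br : ∀ t, 2 ≤ t → ∀ h, G.visits h (z t) →
    G.IsBR u (f t) h (A (t - 1) h) → A t h = A (t - 1) h
  inertia_switch : ∀ t, 2 ≤ t → ∀ h, G.visits h (z t) →
    ¬ G.IsBR u (f t) h (A (t - 1) h) →
    A t h = A (t - 1) h ∨ G.IsBR u (f t) h (A t h)

end ExtGame

open ExtGame

namespace ExtGame

variable {G : ExtGame} {u : G.Node → ℝ} {ρ : ℝ}

lemma pathPairs_root : G.pathPairs G.root = [] := by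
  unfold pathPairs
  cases G.rank G.root with
  | zero => rfl
  | succ k => simp [pathAux, G.parentMove_root]

lemma pathPairs_of_parentMove {n m : G.Node} {a : G.Move} (h : G.parentMove n = some (m, a)) :
    G.pathPairs n = G.pathPairs m ++ [(G.info m, a)] := by
  unfold pathPairs
  rw [G.rank_succ n m a h]
  simp [pathAux, h]

lemma pathPairs_ne_nil {n : G.Node} (hn : ¬ G.decision n) : G.pathPairs n ≠ [] := by
  cases h : G.parentMove n with
  | none => exact absurd (G.eq_root_of_parentMove_eq_none n h ▸ G.root_decision) hn
  | some p => simp [pathPairs_of_parentMove (m := p.1) (a := p.2) h]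

lemma reachProb_nonneg {g : G.Info → G.Move → ℝ} (hg : G.IsProfile g) (n : G.Node) :
    0 ≤ G.reachProb g n := by
  refine List.prod_nonneg fun x hx => ?_
  obtain ⟨p, -, rfl⟩ := List.mem_map.1 hx
  exact hg.1 _ _

/-- The terminal reach probabilities of a profile sum to one. -/
lemma sum_reachProb {g : G.Info → G.Move → ℝ} (hg : G.IsProfile g) :
    ∑ zz ∈ G.terminalSet, G.reachProb g zz = 1 := by
  have hsucc : ∑ n ∈ Finset.univ.erase G.root, G.reachProb g n =
      ∑ m ∈ Finset.univ.filter G.decision, G.reachProb g m := by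
    have hexp : ∀ m ∈ Finset.univ.filter G.decision, G.reachProb g m =
        ∑ a ∈ G.avail (G.info m), G.reachProb g m * g (G.info m) a := fun m _ => by
      rw [← Finset.mul_sum, hg.2.1, mul_one]
    rw [Finset.sum_congr rfl hexp, Finset.sum_sigma']
    symm
    have hmem : ∀ p ∈ (Finset.univ.filter G.decision).sigma fun m => G.avail (G.info m),
        ∃! n', G.parentMove n' = some (p.1, p.2) := fun p hp => by
      simp only [Finset.mem_sigma, Finset.mem_filter, Finset.mem_univ, true_and] at hp
      exact G.child_exists p.1 hp.1 p.2 hp.2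
    refine Finset.sum_bij (fun p hp => (hmem p hp).choose) ?_ ?_ ?_ ?_
    · intro p hp
      have := (hmem p hp).choose_spec.1
      simp only [Finset.mem_erase, Finset.mem_univ, and_true]
      intro h
      simp [h, G.parentMove_root] at this
    · intro p hp q hq h
      have h1 := (hmem p hp).choose_spec.1
      have h2 := (hmem q hq).choose_spec.1
      simp only at h h1 h2
      rw [h, h2] at h1
      obtain ⟨p1, p2⟩ := p
      obtain ⟨q1, q2⟩ := q
      simp only [Option.some.injEq, Prod.mk.injEq] at h1
      rw [h1.1, h1.2]
    · intro n hn
      cases h : G.parentMove n with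
      | none => exact absurd (G.eq_root_of_parentMove_eq_none n h) (Finset.ne_of_mem_erase hn)
      | some p =>
        have hp : (⟨p.1, p.2⟩ : Σ _ : G.Node, G.Move) ∈
            (Finset.univ.filter G.decision).sigma fun m => G.avail (G.info m) := by
          have := G.parent_decision n p.1 p.2 h
          simpa using this
        exact ⟨⟨p.1, p.2⟩, hp, ((hmem _ hp).choose_spec.2 n h).symm⟩
    · intro p hp
      have := (hmem p hp).choose_spec.1
      simp [reachProb, pathPairs_of_parentMove this]
  have hroot : G.reachProb g G.root = 1 := by simp [reachProb, pathPairs_root]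
  have h1 := Finset.add_sum_erase Finset.univ (G.reachProb g) (Finset.mem_univ G.root)
  have h2 := Finset.sum_filter_add_sum_filter_not Finset.univ G.decision (G.reachProb g)
  unfold terminalSet
  linarith

lemma IsProfile.replace {g : G.Info → G.Move → ℝ} (hg : G.IsProfile g) {h : G.Info} {a : G.Move}
    (ha : a ∈ G.avail h) : G.IsProfile (G.replace g h a) := by
  refine ⟨fun h' b => ?_, fun h' => ?_, fun h' b hb => ?_⟩
  · unfold ExtGame.replace
    split_ifs
    · exact zero_le_one
    · exact le_rfl
    · exact hg.1 _ _
  · by_cases hh : h' = h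
    · subst hh
      simp [ExtGame.replace, ha]
    · simpa [ExtGame.replace, hh] using hg.2.1 h'
  · by_cases hh : h' = h
    · subst hh
      have : b ≠ a := fun e => hb (e ▸ ha)
      simp [ExtGame.replace, this]
    · simpa [ExtGame.replace, hh] using hg.2.2 h' b hb

lemma IsProfile.le_one {g : G.Info → G.Move → ℝ} (hg : G.IsProfile g) (h : G.Info) (a : G.Move) :
    g h a ≤ 1 := by
  by_cases ha : a ∈ G.avail h
  · rw [← hg.2.1 h]
    exact Finset.single_le_sum (fun b _ => hg.1 h b) ha
  · rw [hg.2.2 h a ha]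
    exact zero_le_one

lemma mem_terminalSet {n : G.Node} : n ∈ G.terminalSet ↔ ¬ G.decision n := by
  simp [terminalSet]

lemma abs_le_umax {n : G.Node} (hn : ¬ G.decision n) : |u n| ≤ G.umax u := by
  have hfin : {x : ℝ | ∃ zz ∈ G.terminalSet, x = |u zz|}.Finite :=
    (G.terminalSet.finite_toSet.image fun zz => |u zz|).subset
      (by rintro x ⟨zz, hz, rfl⟩; exact ⟨zz, hz, rfl⟩)
  exact le_csSup hfin.bddAbove ⟨n, mem_terminalSet.2 hn, rfl⟩

lemma dmin_le {n m : G.Node} (hn : ¬ G.decision n) (hm : ¬ G.decision m) (hne : n ≠ m) :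
    G.dmin u ≤ |u n - u m| := by
  refine csInf_le ⟨0, ?_⟩ ⟨n, mem_terminalSet.2 hn, m, mem_terminalSet.2 hm, hne, rfl⟩
  rintro x ⟨zz, -, zz', -, -, rfl⟩
  exact abs_nonneg _

lemma dmin_pos
    (hdistinct : ∀ zz zz' : G.Node, ¬ G.decision zz → ¬ G.decision zz' → u zz = u zz' → zz = zz')
    {n m : G.Node} (hn : ¬ G.decision n) (hm : ¬ G.decision m) (hne : n ≠ m) :
    0 < G.dmin u := by
  have hfin : {x : ℝ | ∃ zz ∈ G.terminalSet, ∃ zz' ∈ G.terminalSet,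
      zz ≠ zz' ∧ x = |u zz - u zz'|}.Finite :=
    (Set.finite_range fun p : G.Node × G.Node => |u p.1 - u p.2|).subset
      (by rintro x ⟨zz, -, zz', -, -, rfl⟩; exact ⟨(zz, zz'), rfl⟩)
  have hmem : G.dmin u ∈ {x : ℝ | ∃ zz ∈ G.terminalSet, ∃ zz' ∈ G.terminalSet,
      zz ≠ zz' ∧ x = |u zz - u zz'|} := Set.Nonempty.csInf_mem
    ⟨_, n, mem_terminalSet.2 hn, m, mem_terminalSet.2 hm, hne, rfl⟩ hfin
  obtain ⟨zz, hz, zz', hz', hzz, hx⟩ := hmem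
  rw [hx, abs_pos, sub_ne_zero]
  exact fun e => hzz (hdistinct _ _ (mem_terminalSet.1 hz) (mem_terminalSet.1 hz') e)

lemma lmax_pos : 0 < G.lmax := by
  obtain ⟨n, hn⟩ := G.exists_terminal
  exact (List.length_pos_iff.2 (pathPairs_ne_nil hn)).trans_le
    (Finset.le_sup (f := fun zz => (G.pathPairs zz).length) (mem_terminalSet.2 hn))

lemma dmin_le_two_mul_umax {n m : G.Node} (hn : ¬ G.decision n) (hm : ¬ G.decision m)
    (hne : n ≠ m) : G.dmin u ≤ 2 * G.umax u := by
  have h1 := dmin_le (u := u) hn hm hne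
  have h2 := abs_sub (u n) (u m)
  have h3 := abs_le_umax (u := u) hn
  have h4 := abs_le_umax (u := u) hm
  linarith

lemma thr_base_nonneg (hd : 0 < G.dmin u) (hdu : G.dmin u ≤ 2 * G.umax u) :
    0 ≤ 1 - G.dmin u / (8 * G.umax u) := by
  rw [sub_nonneg, div_le_one (by linarith)]
  linarith

lemma thr_nonneg (hd : 0 < G.dmin u) (hdu : G.dmin u ≤ 2 * G.umax u) : 0 ≤ G.thr u :=
  Real.rpow_nonneg (thr_base_nonneg hd hdu) _

lemma thr_lt_one (hd : 0 < G.dmin u) (hdu : G.dmin u ≤ 2 * G.umax u) : G.thr u < 1 := by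
  refine Real.rpow_lt_one (thr_base_nonneg hd hdu) ?_
    (inv_pos.2 (Nat.cast_pos.2 lmax_pos))
  have : 0 < G.dmin u / (8 * G.umax u) := div_pos hd (by linarith)
  linarith

lemma thr_pow_lmax (hd : 0 < G.dmin u) (hdu : G.dmin u ≤ 2 * G.umax u) :
    G.thr u ^ G.lmax = 1 - G.dmin u / (8 * G.umax u) :=
  Real.rpow_inv_natCast_pow (thr_base_nonneg hd hdu) lmax_pos.ne'

/-- If every move on the path to `n` has probability at least the threshold, the expected payoff
is within `Δ_min / 4` of `u n`. -/
lemma abs_eu_sub_le {g : G.Info → G.Move → ℝ} (hg : G.IsProfile g) {n : G.Node}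
    (hn : ¬ G.decision n) (hd : 0 < G.dmin u) (hdu : G.dmin u ≤ 2 * G.umax u)
    (hp : ∀ p ∈ G.pathPairs n, G.thr u ≤ g p.1 p.2) :
    |G.eu u g - u n| ≤ G.dmin u / 4 := by
  have hu : 0 < G.umax u := by linarith
  have hreach : 1 - G.dmin u / (8 * G.umax u) ≤ G.reachProb g n := by
    have hlist : ∀ l : List (G.Info × G.Move), (∀ p ∈ l, G.thr u ≤ g p.1 p.2) →
        G.thr u ^ l.length ≤ (l.map fun p => g p.1 p.2).prod := by
      intro l
      induction l with
      | nil => simp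
      | cons p l ih =>
        intro h
        rw [List.length_cons, pow_succ', List.map_cons, List.prod_cons]
        exact mul_le_mul (h p (by simp)) (ih fun q hq => h q (by simp [hq]))
          (pow_nonneg (thr_nonneg hd hdu) _) (hg.1 _ _)
    rw [← thr_pow_lmax hd hdu]
    refine le_trans ?_ (hlist _ hp)
    exact pow_le_pow_of_le_one (thr_nonneg hd hdu) (thr_lt_one hd hdu).le
      (Finset.le_sup (f := fun zz => (G.pathPairs zz).length) (mem_terminalSet.2 hn))
  have hdiff : G.eu u g - u n = ∑ zz ∈ G.terminalSet.erase n, (u zz - u n) * G.reachProb g zz := by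
    have h1 : G.eu u g - u n = ∑ zz ∈ G.terminalSet, (u zz - u n) * G.reachProb g zz := by
      simp_rw [sub_mul]
      rw [Finset.sum_sub_distrib, ← Finset.mul_sum, sum_reachProb hg, mul_one, eu]
    rw [h1, ← Finset.add_sum_erase _ _ (mem_terminalSet.2 hn)]
    simp
  have hrest : ∑ zz ∈ G.terminalSet.erase n, G.reachProb g zz ≤ G.dmin u / (8 * G.umax u) := by
    have h1 := Finset.add_sum_erase _ (G.reachProb g) (mem_terminalSet.2 hn)
    rw [sum_reachProb hg] at h1
    linarith
  rw [hdiff]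
  calc |∑ zz ∈ G.terminalSet.erase n, (u zz - u n) * G.reachProb g zz|
      ≤ ∑ zz ∈ G.terminalSet.erase n, |(u zz - u n) * G.reachProb g zz| :=
        Finset.abs_sum_le_sum_abs _ _
    _ ≤ ∑ zz ∈ G.terminalSet.erase n, 2 * G.umax u * G.reachProb g zz := by
        refine Finset.sum_le_sum fun zz hz => ?_
        rw [abs_mul, abs_of_nonneg (reachProb_nonneg hg zz)]
        refine mul_le_mul_of_nonneg_right ?_ (reachProb_nonneg hg zz)
        have h2 := abs_sub (u zz) (u n)
        have h3 := abs_le_umax (u := u) (mem_terminalSet.1 (Finset.mem_of_mem_erase hz))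
        have h4 := abs_le_umax (u := u) hn
        linarith
    _ ≤ 2 * G.umax u * (G.dmin u / (8 * G.umax u)) := by
        rw [← Finset.mul_sum]
        exact mul_le_mul_of_nonneg_left hrest (by linarith)
    _ = G.dmin u / 4 := by
        field_simp
        norm_num

lemma fadeStep_iterate_of_mem {zz : G.Node} {p : G.Info × G.Move} (hp : p ∈ G.pathPairs zz)
    (g : G.Info → G.Move → ℝ) (k : ℕ) :
    (G.fadeStep ρ zz)^[k] g p.1 p.2 = 1 - (1 - ρ) ^ k * (1 - g p.1 p.2) := by
  have hc : G.chooses p.1 p.2 zz := hp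
  have hv : G.visits p.1 zz := ⟨p.2, hc⟩
  induction k with
  | zero => simp
  | succ k ih =>
    rw [Function.iterate_succ_apply', fadeStep, ih, visitInd, chooseInd, if_pos hv, if_pos hc]
    ring

lemma fadeStep_iterate_of_not_visits {zz : G.Node} {h : G.Info} (hh : ¬ G.visits h zz)
    (g : G.Info → G.Move → ℝ) (k : ℕ) : (G.fadeStep ρ zz)^[k] g h = g h := by
  induction k with
  | zero => rfl
  | succ k ih =>
    rw [Function.iterate_succ_apply']
    funext a
    simp [fadeStep, visitInd, hh, ih]

namespace IsFPInertiaPath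

variable {α : G.Info → ℝ} {f : ℕ → G.Info → G.Move → ℝ} {A : ℕ → G.Info → G.Move}
  {z : ℕ → G.Node}

lemma freq_of_repeat (hFP : G.IsFPInertiaPath u ρ α f A z) {t N : ℕ} (ht : 1 ≤ t)
    (hz : ∀ k ≤ N, z (t + k) = z t) : f (t + N + 1) = (G.fadeStep ρ (z t))^[N + 1] (f t) := by
  have : ∀ k ≤ N + 1, f (t + k) = (G.fadeStep ρ (z t))^[k] (f t) := by
    intro k
    induction k with
    | zero => simp
    | succ k ih =>
      intro hk
      rw [Function.iterate_succ_apply', ← ih (by omega), ← add_assoc,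
        hFP.update (t + k) (by omega), hz k (by omega)]
  exact this (N + 1) le_rfl

lemma action_of_repeat (hFP : G.IsFPInertiaPath u ρ α f A z) {t N : ℕ} (ht : 1 ≤ t)
    (hz : ∀ k ≤ N, z (t + 1 + k) = z (t + 1)) {h : G.Info} (hh : ¬ G.visits h (z (t + 1))) :
    A (t + 1 + N) h = A t h := by
  have : ∀ k ≤ N + 1, A (t + k) h = A t h := by
    intro k
    induction k with
    | zero => simp
    | succ k ih =>
      intro hk
      have hv : ¬ G.visits h (z (t + (k + 1))) := by
        rw [show t + (k + 1) = t + 1 + k by omega, hz k (by omega)]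
        exact hh
      rw [hFP.inertia_unreached _ (by omega) h hv, ← ih (by omega)]
      congr 1
  rw [show t + 1 + N = t + (N + 1) by omega]
  exact this _ le_rfl

lemma Kt_spec (hFP : G.IsFPInertiaPath u ρ α f A z) (hthr : G.thr u < 1) {t : ℕ} (ht : 1 ≤ t) :
    ∀ p ∈ G.pathPairs (z t), G.thr u ≤ (1 - ρ) ^ (G.Kt u ρ f z t + 1) * f t p.1 p.2 + 1 -
      (1 - ρ) ^ (G.Kt u ρ f z t + 1) := by
  have hne : {K : ℕ | ∀ p ∈ G.pathPairs (z t),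
      G.thr u ≤ (1 - ρ) ^ (K + 1) * f t p.1 p.2 + 1 - (1 - ρ) ^ (K + 1)}.Nonempty := by
    have hρ := hFP.rho_mem
    have h0 : 0 ≤ 1 - ρ := by linarith [hρ.2]
    obtain ⟨K, hK⟩ := exists_pow_lt_of_lt_one (sub_pos.2 hthr) (show 1 - ρ < 1 by linarith [hρ.1])
    refine ⟨K, fun p _ => ?_⟩
    have h1 : (1 - ρ) ^ (K + 1) ≤ (1 - ρ) ^ K :=
      pow_le_pow_of_le_one h0 (by linarith [hρ.1]) K.le_succ
    have h2 : 0 ≤ (1 - ρ) ^ (K + 1) * f t p.1 p.2 :=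
      mul_nonneg (pow_nonneg h0 _) ((hFP.profile t ht).1 _ _)
    linarith
  exact Nat.sInf_mem hne

lemma thr_le_freq_of_mem (hFP : G.IsFPInertiaPath u ρ α f A z) (hthr : G.thr u < 1) {t m : ℕ}
    (ht : 1 ≤ t) (hz : ∀ k ≤ G.Kt u ρ f z t + m, z (t + k) = z t) {p : G.Info × G.Move}
    (hp : p ∈ G.pathPairs (z t)) :
    G.thr u ≤ f (t + (G.Kt u ρ f z t + m) + 1) p.1 p.2 := by
  rw [hFP.freq_of_repeat ht hz, fadeStep_iterate_of_mem hp]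
  refine (hFP.Kt_spec hthr ht p hp).trans ?_
  have hρ := hFP.rho_mem
  have h1 : (1 - ρ) ^ (G.Kt u ρ f z t + m + 1) ≤ (1 - ρ) ^ (G.Kt u ρ f z t + 1) :=
    pow_le_pow_of_le_one (by linarith [hρ.2]) (by linarith [hρ.1]) (by omega)
  have h2 := mul_le_mul_of_nonneg_right h1 (sub_nonneg.2 ((hFP.profile t ht).le_one p.1 p.2))
  linarith

lemma one_le_tseq {t0 : ℕ} (ht0 : 1 ≤ t0) (i : ℕ) : 1 ≤ G.tseq u ρ f z t0 i := by
  cases i with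
  | zero => exact ht0
  | succ i => simp [tseq]

/-- After the `i`-th block of repetitions, at each information set visited in some block so far,
the most recent move has empirical frequency above the threshold. -/
lemma thr_le_freq_lastMove (hFP : G.IsFPInertiaPath u ρ α f A z) (hthr : G.thr u < 1)
    {t0 n : ℕ} (ht0 : 1 ≤ t0)
    (hrep : ∀ i ≤ n, ∀ k ≤ G.Kt u ρ f z (G.tseq u ρ f z t0 i) +
      (G.mt u ρ f z (G.tseq u ρ f z t0 i)).toNat,
      z (G.tseq u ρ f z t0 i + k) = z (G.tseq u ρ f z t0 i))
    {i : ℕ} (hi : i ≤ n) {j : ℕ} (hj : j ≤ i) {h : G.Info}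
    (hh : G.visits h (z (G.tseq u ρ f z t0 j))) :
    G.thr u ≤ f (G.st u ρ f z (G.tseq u ρ f z t0 i) + 1) h
      (A (G.st u ρ f z (G.tseq u ρ f z t0 i)) h) := by
  have hvis : ∀ i ≤ n, G.visits h (z (G.tseq u ρ f z t0 i)) →
      G.thr u ≤ f (G.st u ρ f z (G.tseq u ρ f z t0 i) + 1) h
        (A (G.st u ρ f z (G.tseq u ρ f z t0 i)) h) := by
    rintro i hi ⟨a, ha⟩
    have hpos := one_le_tseq (u := u) (ρ := ρ) (f := f) (z := z) ht0 i
    have hA : A (G.st u ρ f z (G.tseq u ρ f z t0 i)) h = a := by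
      refine hFP.outcome _ (by unfold st; omega) (h, a) ?_
      rw [st, add_assoc, hrep i hi _ le_rfl]
      exact ha
    have hf := hFP.thr_le_freq_of_mem hthr hpos (hrep i hi) (p := (h, a)) ha
    rw [hA, st, add_assoc (G.tseq u ρ f z t0 i)]
    exact hf
  induction i generalizing j with
  | zero =>
    obtain rfl : j = 0 := by omega
    exact hvis 0 hi hh
  | succ i ih =>
    by_cases hv : G.visits h (z (G.tseq u ρ f z t0 (i + 1)))
    · exact hvis _ hi hv
    · have hji : j ≤ i := by
        rcases Nat.lt_or_ge i j with hlt | hge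
        · obtain rfl : j = i + 1 := by omega
          exact absurd hh hv
        · exact hge
      have hprev := ih (by omega) hji hh
      have hr := hrep (i + 1) hi
      have hpos := one_le_tseq (u := u) (ρ := ρ) (f := f) (z := z) ht0 (i + 1)
      have hst : 1 ≤ G.st u ρ f z (G.tseq u ρ f z t0 i) := by
        have := one_le_tseq (u := u) (ρ := ρ) (f := f) (z := z) ht0 i
        unfold st
        omega
      have hA := hFP.action_of_repeat hst hr hv
      have hf := hFP.freq_of_repeat hpos hr
      have hf' := congrFun hf h
      rw [fadeStep_iterate_of_not_visits hv] at hf'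
      rw [st, add_assoc (G.tseq u ρ f z t0 (i + 1)), hf']
      simp only [tseq] at hA ⊢
      rw [hA]
      exact hprev

end IsFPInertiaPath

end ExtGame

/-- **Lemma 2.** Under FP with inertia and fading memory in a
common-payoff game with pairwise-distinct terminal payoffs, if the events
`Ê_{t_0} ∩ … ∩ Ê_{t_n}` occur (with `t_{ℓ+1} = t_ℓ + K_{t_ℓ} + m_{t_ℓ} + 1` and all
`m_{t_ℓ} < ∞`), then any revisited terminal node strictly improves the payoff:
`z_{t_{ℓ+1}} ∈ {z_{t_0},…,z_{t_ℓ}}` implies `u(z_{t_{ℓ+1}}) > u(z_{t_ℓ})`. -/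
theorem fp_inertia_revisit_improves (G : ExtGame)
    (u : G.Node → ℝ) (hPR : G.PerfectRecall)
    (hdistinct : ∀ zz zz' : G.Node, ¬ G.decision zz → ¬ G.decision zz' →
      u zz = u zz' → zz = zz')
    (ρ : ℝ) (α : G.Info → ℝ)
    (f : ℕ → G.Info → G.Move → ℝ) (A : ℕ → G.Info → G.Move) (z : ℕ → G.Node)
    (hFP : G.IsFPInertiaPath u ρ α f A z)
    (t0 : ℕ) (ht0 : 1 ≤ t0) (n : ℕ)
    (hfin : ∀ ℓ ≤ n, G.mt u ρ f z (G.tseq u ρ f z t0 ℓ) ≠ ⊤)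
    (hE : ∀ ℓ ≤ n, G.deviateEvent u ρ f z A (G.tseq u ρ f z t0 ℓ)) :
    ∀ ℓ ≤ n,
      (∃ j ≤ ℓ, z (G.tseq u ρ f z t0 (ℓ + 1)) = z (G.tseq u ρ f z t0 j)) →
        u (z (G.tseq u ρ f z t0 ℓ)) < u (z (G.tseq u ρ f z t0 (ℓ + 1))) := by
  intro ℓ hℓ ⟨j, hj, hzj⟩
  have hrep : ∀ i ≤ n, ∀ k ≤ G.Kt u ρ f z (G.tseq u ρ f z t0 i) +
      (G.mt u ρ f z (G.tseq u ρ f z t0 i)).toNat,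
      z (G.tseq u ρ f z t0 i + k) = z (G.tseq u ρ f z t0 i) := by
    intro i hi
    have h := (hE i hi).1
    rwa [repeatLockEvent, if_neg (hfin i hi)] at h
  have hpos := IsFPInertiaPath.one_le_tseq (u := u) (ρ := ρ) (f := f) (z := z) ht0 ℓ
  obtain ⟨hterm', hbar, abar, ahat, hbar_mem, hahat, hlt, hpath⟩ := (hE ℓ hℓ).2
  have hzs : z (G.st u ρ f z (G.tseq u ρ f z t0 ℓ)) = z (G.tseq u ρ f z t0 ℓ) := by
    rw [st, add_assoc]
    exact hrep ℓ hℓ _ le_rfl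
  have hs : 1 ≤ G.st u ρ f z (G.tseq u ρ f z t0 ℓ) := by
    unfold st
    omega
  have hout := hFP.outcome _ hs
  have hvalid := hFP.pure_valid _ hs
  have hprof := hFP.profile (G.st u ρ f z (G.tseq u ρ f z t0 ℓ) + 1) (by omega)
  have hterm := hFP.terminal _ hpos
  rw [hzs] at hbar_mem hout
  have habar : abar ∈ G.avail hbar := by
    have h : A _ hbar = abar := hout _ hbar_mem
    exact h ▸ hvalid hbar
  change z (G.st u ρ f z (G.tseq u ρ f z t0 ℓ) + 1) = _ at hzj
  change _ < u (z (G.st u ρ f z (G.tseq u ρ f z t0 ℓ) + 1))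
  have hne : z (G.st u ρ f z (G.tseq u ρ f z t0 ℓ) + 1) ≠ z (G.tseq u ρ f z t0 ℓ) := by
    intro e
    have h := hpath (hbar, abar) (e ▸ hbar_mem)
    simp only [if_true] at h
    exact hlt.ne (by rw [h])
  have hd := dmin_pos hdistinct hterm' hterm hne
  have hdu := dmin_le_two_mul_umax (u := u) hterm' hterm hne
  have hthr := thr_lt_one hd hdu
  have hfreq : ∀ i ≤ ℓ, ∀ p ∈ G.pathPairs (z (G.tseq u ρ f z t0 i)),
      G.thr u ≤ f (G.st u ρ f z (G.tseq u ρ f z t0 ℓ) + 1) p.1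
        (A (G.st u ρ f z (G.tseq u ρ f z t0 ℓ)) p.1) := fun i hi p hp =>
    hFP.thr_le_freq_lastMove hthr ht0 hrep hℓ hi ⟨p.2, hp⟩
  have hold := abs_eu_sub_le (hprof.replace habar) hterm hd hdu (by
    intro p hp
    by_cases hph : p.1 = hbar
    · have : p.2 = abar := by rw [← hout p hp, hph, hout _ hbar_mem]
      simpa [ExtGame.replace, hph, this] using hthr.le
    · simpa [ExtGame.replace, hph, hout p hp] using hfreq ℓ le_rfl p hp)
  have hnew := abs_eu_sub_le (hprof.replace hahat) hterm' hd hdu (by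
    intro p hp
    have hp2 := hpath p hp
    by_cases hph : p.1 = hbar
    · rw [if_pos hph] at hp2
      simpa [ExtGame.replace, hph, hp2] using hthr.le
    · rw [if_neg hph] at hp2
      simpa [ExtGame.replace, hph, hp2] using hfreq j hj p (hzj ▸ hp))
  have hgap := dmin_le (u := u) hterm' hterm hne
  rw [abs_le] at hold hnew
  rcases le_abs.1 hgap with h | h <;> linarith [hold.1, hold.2, hnew.1, hnew.2]
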